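/- arXiv:2601.03275 — 2 statements merged into one kernel-verified Lean document; each statement's English description precedes it below -/
import Mathlib

section
/- Let X be a topological space, Y a real normed vector space with the metric induced by its norm, A ⊆ Y a nonempty subset, and f : X → Y a continuous map. Then the well function f_A coincides with the distance-to-A function: for every x ∈ X, sInf {r : ℝ | 0 ≤ r ∧ ∃ g : C(X, Y), (∀ x' ∈ X, ‖f(x') − g(x')‖ ≤ r) ∧ g(x) ∈ A} = infDist(f(x), A). -/
/-- In a real normed vector space `Y`, the well function coincides with the distance-to-`A`
function: `f_A(x) = infDist (f x) A` for every `x`. -/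
theorem wellFn_eq_infDist
    {X : Type*} {Y : Type*} [TopologicalSpace X] [NormedAddCommGroup Y] [NormedSpace ℝ Y]
    (A : Set Y) (hA : A.Nonempty) (f : C(X, Y)) (x : X) :
    sInf {r : ℝ | 0 ≤ r ∧
        ∃ g : C(X, Y), (∀ x' : X, ‖f x' - g x'‖ ≤ r) ∧ g x ∈ A}
      = Metric.infDist (f x) A := by
  have mem_of_mem : ∀ a ∈ A, dist (f x) a ∈ {r : ℝ | 0 ≤ r ∧
      ∃ g : C(X, Y), (∀ x' : X, ‖f x' - g x'‖ ≤ r) ∧ g x ∈ A} := fun a ha =>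
    ⟨dist_nonneg, f + ContinuousMap.const X (a - f x), fun x' => by
      simp [dist_eq_norm], by simpa using ha⟩
  apply le_antisymm
  · exact (Metric.le_infDist hA).2 fun {a} ha =>
      csInf_le ⟨0, fun r hr => hr.1⟩ (mem_of_mem a ha)
  · obtain ⟨a, ha⟩ := hA
    refine le_csInf ⟨_, mem_of_mem a ha⟩ ?_
    rintro r ⟨-, g, hg, hgA⟩
    exact (Metric.infDist_le_dist_of_mem hgA).trans (by simpa [dist_eq_norm] using hg x)
end

section
/- Let X be a normal topological space, Y a real normed vector space, f, g, g' : X → Y continuous maps, and r ≥ 0. Suppose ‖f(x) − g(x)‖ ≤ r and ‖f(x) − g'(x)‖ ≤ r for all x ∈ X, and let C, C' ⊆ X be disjoint closed sets such that g(x) ≠ 0 for all x ∈ C and g'(x) ≠ 0 for all x ∈ C'. Then there exists a continuous map h : X → Y with ‖f(x) − h(x)‖ ≤ r for all x ∈ X and h(x) ≠ 0 for all x ∈ C ∪ C'. -/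
/-- Gluing of perturbations (Lemma: extend perturbations). Let `X` be normal, `Y` a real
normed vector space, and `g, g'` two `r`-perturbations of `f`. If `C, C'` are disjoint
closed sets such that `g` has no zero on `C` and `g'` has no zero on `C'`, then there is
an `r`-perturbation `h` of `f` with no zero on `C ∪ C'`. -/
theorem exists_perturbation_no_zero_union
    {X Y : Type*} [TopologicalSpace X] [NormalSpace X]
    [NormedAddCommGroup Y] [NormedSpace ℝ Y]
    (f g g' : X → Y) (hf : Continuous f) (hg : Continuous g) (hg' : Continuous g')
    (r : ℝ) (hr : 0 ≤ r)
    (hgr : ∀ x : X, ‖f x - g x‖ ≤ r) (hg'r : ∀ x : X, ‖f x - g' x‖ ≤ r)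
    (C C' : Set X) (hC : IsClosed C) (hC' : IsClosed C') (hdisj : Disjoint C C')
    (hgC : ∀ x ∈ C, g x ≠ 0) (hg'C' : ∀ x ∈ C', g' x ≠ 0) :
    ∃ h : X → Y, Continuous h ∧ (∀ x : X, ‖f x - h x‖ ≤ r) ∧
      ∀ x ∈ C ∪ C', h x ≠ 0 := by
  obtain ⟨φ, hφC', hφC, hφ⟩ := exists_continuous_zero_one_of_isClosed hC' hC hdisj.symm
  refine ⟨fun x => φ x • g x + (1 - φ x) • g' x, by fun_prop, fun x => ?_, ?_⟩
  · rw [← dist_eq_norm, ← Metric.mem_closedBall']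
    refine convex_closedBall (f x) r ?_ ?_ (hφ x).1 (sub_nonneg.2 (hφ x).2) (by ring)
    · rw [Metric.mem_closedBall', dist_eq_norm]; exact hgr x
    · rw [Metric.mem_closedBall', dist_eq_norm]; exact hg'r x
  · rintro x (hx | hx)
    · simpa [hφC hx] using hgC x hx
    · simpa [hφC' hx] using hg'C' x hx
end
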